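/- Let d, M be positive natural numbers, let ᾱ ∈ (0,1), let J be a finite index set with weights w : J → ℝ, and let m : J → EuclideanSpace ℝ (Fin d) → EuclideanSpace ℝ (Fin d) and m* : EuclideanSpace ℝ (Fin d) → EuclideanSpace ℝ (Fin d) be functions. Suppose that for every x, ∑_{j ∈ J} w j • ((1/(1−ᾱ)) • ((√ᾱ) • m j x − x)) = (1/(1−ᾱ)) • ((√ᾱ) • m* x − x), and suppose that the function x ↦ ∑_{j ∈ J} w j • m j x − m* x is bounded on EuclideanSpace ℝ (Fin d). Then ∑_{j ∈ J} w j = 1. -/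

import Mathlib

open Real MeasureTheory

/-- A homothety of a nontrivial real normed space with bounded range is zero. -/
theorem eq_zero_of_forall_norm_smul_le {E : Type*} [NormedAddCommGroup E] [NormedSpace ℝ E]
    [Nontrivial E] {c C : ℝ} (h : ∀ x : E, ‖c • x‖ ≤ C) : c = 0 := by
  by_contra hc
  obtain ⟨x, hx⟩ := NormedSpace.exists_lt_norm ℝ E C
  have hle := h (c⁻¹ • x)
  rw [smul_inv_smul₀ hc] at hle
  exact absurd hx hle.not_gt

/-- If a weighted sum of the affine expressions `a • (s • y j - x)` equals `a • (s • z - x)` with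
`a ≠ 0`, then the excess of the total weight over `1` scales `x` to the scaled discrepancy. -/
theorem sum_sub_one_smul_eq {E J : Type*} [AddCommGroup E] [Module ℝ E] [Fintype J]
    {a s : ℝ} (ha : a ≠ 0) {w : J → ℝ} {y : J → E} {x z : E}
    (h : ∑ j, w j • (a • (s • y j - x)) = a • (s • z - x)) :
    ((∑ j, w j) - 1) • x = s • ((∑ j, w j • y j) - z) := by
  simp only [smul_comm (w _) a, ← Finset.smul_sum] at h
  have h' := smul_right_injective E ha h
  simp only [smul_sub, Finset.sum_sub_distrib, smul_comm (w _) s, ← Finset.smul_sum,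
    ← Finset.sum_smul] at h'
  rw [sub_smul, one_smul, smul_sub, sub_eq_sub_iff_add_eq_add]
  rw [sub_eq_sub_iff_add_eq_add] at h'
  rw [h', add_comm]

/-- Theorem A.3 ('only if' direction): if the weighted combination of pairwise
scores equals the true score at every point, and the weighted posterior-mean
predictions differ from the full posterior mean by a bounded function, then the
weights must sum to `1`. -/
theorem cvd_weights_sum_to_one
    (d M : ℕ) (hd : 0 < d) (hM : 0 < M)
    (ᾱ : ℝ) (hᾱ : ᾱ ∈ Set.Ioo (0 : ℝ) 1)
    (J : Type*) [Fintype J] (w : J → ℝ)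
    (m : J → EuclideanSpace ℝ (Fin d) → EuclideanSpace ℝ (Fin d))
    (mStar : EuclideanSpace ℝ (Fin d) → EuclideanSpace ℝ (Fin d))
    (hscore : ∀ x : EuclideanSpace ℝ (Fin d),
      ∑ j : J, w j • ((1 / (1 - ᾱ)) • ((Real.sqrt ᾱ) • m j x - x)) =
        (1 / (1 - ᾱ)) • ((Real.sqrt ᾱ) • mStar x - x))
    (hbdd : ∃ C : ℝ, ∀ x : EuclideanSpace ℝ (Fin d),
      ‖(∑ j : J, w j • m j x) - mStar x‖ ≤ C) :
    ∑ j : J, w j = 1 := by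
  obtain ⟨C, hC⟩ := hbdd
  have : Nonempty (Fin d) := ⟨⟨0, hd⟩⟩
  have ha : 1 / (1 - ᾱ) ≠ 0 := one_div_ne_zero (sub_pos.2 hᾱ.2).ne'
  refine sub_eq_zero.1 (eq_zero_of_forall_norm_smul_le
    (E := EuclideanSpace ℝ (Fin d)) (C := Real.sqrt ᾱ * C) fun x => ?_)
  rw [sum_sub_one_smul_eq ha (hscore x), norm_smul, Real.norm_of_nonneg (Real.sqrt_nonneg ᾱ)]
  exact mul_le_mul_of_nonneg_left (hC x) (Real.sqrt_nonneg ᾱ)
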